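/- (Exponential stability of the filter flow under two-sided bounds; key ingredient of Proposition 3.2.) Let (S,𝒮,λ) be a measurable space with a finite nonzero measure λ. Let 0 < c ≤ C < ∞, let q : S×S → ℝ be measurable with c ≤ q(x,z) ≤ C for all x,z, and for each p ∈ ℕ let h_p : S → ℝ be measurable with c ≤ h_p(z) ≤ C for all z. For p ∈ ℕ define the filter update map Φ_p on probability measures on S by Φ_p(μ)(A) := [ ∫∫ 1_A(z) h_p(z) q(x,z) λ(dz) μ(dx) ] / [ ∫∫ h_p(z) q(x,z) λ(dz) μ(dx) ]. Then there exist ρ ∈ (0,1) and C' < ∞, depending only on c, C and λ(S), such that for all integers 0 ≤ p < n and all probability measures μ, ν on S: ‖ (Φ_n ∘ ⋯ ∘ Φ_{p+1})(μ) − (Φ_n ∘ ⋯ ∘ Φ_{p+1})(ν) ‖_TV ≤ C' ρ^{n−p} ‖μ − ν‖_TV. -/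

import Mathlib

open MeasureTheory
open scoped ENNReal NNReal

/-- Total variation distance `‖μ−ν‖_TV := sup_A |μ(A) − ν(A)|`, supremum over measurable sets. -/
noncomputable def tvDist {α : Type*} [MeasurableSpace α] (μ ν : Measure α) : ℝ :=
  ⨆ s : {s : Set α // MeasurableSet s}, |(μ s.1).toReal - (ν s.1).toReal|

/-- The filter update map
`Φ_p(μ)(A) = (∫∫ 1_A(z) h_p(z) q(x,z) λ(dz) μ(dx)) / (∫∫ h_p(z) q(x,z) λ(dz) μ(dx))`,
written as the normalization of the measure with `λ`-density `z ↦ h_p(z) ∫ q(x,z) μ(dx)`. -/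
noncomputable def filterStep {S : Type*} [MeasurableSpace S] (lam : Measure S)
    (q : S → S → ℝ) (h : ℕ → S → ℝ) (p : ℕ) (μ : Measure S) : Measure S :=
  (∫⁻ z, ENNReal.ofReal (h p z * ∫ x, q x z ∂μ) ∂lam)⁻¹ •
    lam.withDensity fun z => ENNReal.ofReal (h p z * ∫ x, q x z ∂μ)

section TotalVariation

variable {α : Type*} [MeasurableSpace α]

theorem tvDist_comm (μ ν : Measure α) : tvDist μ ν = tvDist ν μ := by
  simp only [tvDist, abs_sub_comm]

theorem tvDist_nonneg (μ ν : Measure α) : 0 ≤ tvDist μ ν :=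
  Real.iSup_nonneg fun _ => abs_nonneg _

theorem sub_le_tvDist (μ ν : Measure α) [IsProbabilityMeasure μ] [IsProbabilityMeasure ν]
    {A : Set α} (hA : MeasurableSet A) : μ.real A - ν.real A ≤ tvDist μ ν := by
  have hbdd : BddAbove (Set.range fun s : {s : Set α // MeasurableSet s} =>
      |(μ s.1).toReal - (ν s.1).toReal|) := by
    refine ⟨1, ?_⟩
    rintro _ ⟨s, rfl⟩
    have h1 : (μ s.1).toReal ≤ 1 := measureReal_le_one
    have h2 : (ν s.1).toReal ≤ 1 := measureReal_le_one
    have h3 : 0 ≤ (μ s.1).toReal := ENNReal.toReal_nonneg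
    have h4 : 0 ≤ (ν s.1).toReal := ENNReal.toReal_nonneg
    exact abs_le.2 ⟨by linarith, by linarith⟩
  exact (le_abs_self _).trans (le_ciSup hbdd ⟨A, hA⟩)

theorem integrable_of_mem_Icc (μ : Measure α) [IsFiniteMeasure μ] {f : α → ℝ} {c C : ℝ}
    (hf : Measurable f) (hfc : ∀ x, f x ∈ Set.Icc c C) : Integrable f μ :=
  Integrable.of_mem_Icc c C hf.aemeasurable (Filter.Eventually.of_forall hfc)

theorem integral_mem_Icc (μ : Measure α) [IsProbabilityMeasure μ] {f : α → ℝ} {c C : ℝ}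
    (hf : Measurable f) (hfc : ∀ x, f x ∈ Set.Icc c C) : ∫ x, f x ∂μ ∈ Set.Icc c C := by
  have hi := integrable_of_mem_Icc μ hf hfc
  constructor
  · simpa using integral_mono (integrable_const c) hi fun x => (hfc x).1
  · simpa using integral_mono hi (integrable_const C) fun x => (hfc x).2

/-- Total variation controls the difference of the integrals of a bounded function, with the
oscillation of the function as constant. -/
theorem integral_sub_integral_le_tvDist (μ ν : Measure α) [IsProbabilityMeasure μ]
    [IsProbabilityMeasure ν] {f : α → ℝ} {c C : ℝ} (hcC : c ≤ C) (hf : Measurable f)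
    (hfc : ∀ x, f x ∈ Set.Icc c C) :
    ∫ x, f x ∂μ - ∫ x, f x ∂ν ≤ (C - c) * tvDist μ ν := by
  obtain ⟨A, hA, hpos, hneg⟩ := hahn_decomposition μ ν
  have hle : ν.restrict A ≤ μ.restrict A := by
    refine Measure.le_iff.2 fun s hs => ?_
    rw [Measure.restrict_apply hs, Measure.restrict_apply hs]
    exact hpos _ (hs.inter hA) Set.inter_subset_right
  have hge : μ.restrict Aᶜ ≤ ν.restrict Aᶜ := by
    refine Measure.le_iff.2 fun s hs => ?_
    rw [Measure.restrict_apply hs, Measure.restrict_apply hs]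
    exact hneg _ (hs.inter hA.compl) Set.inter_subset_right
  have hiμ := integrable_of_mem_Icc μ hf hfc
  have hiν := integrable_of_mem_Icc ν hf hfc
  have h1 : ∫ x in A, (C - f x) ∂ν ≤ ∫ x in A, (C - f x) ∂μ :=
    integral_mono_measure hle (Filter.Eventually.of_forall fun x => sub_nonneg.2 (hfc x).2)
      ((integrable_const C).sub hiμ).restrict
  have h2 : ∫ x in Aᶜ, (f x - c) ∂μ ≤ ∫ x in Aᶜ, (f x - c) ∂ν :=
    integral_mono_measure hge (Filter.Eventually.of_forall fun x => sub_nonneg.2 (hfc x).1)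
      (hiν.sub (integrable_const c)).restrict
  rw [integral_sub (integrable_const C) hiμ.restrict,
    integral_sub (integrable_const C) hiν.restrict] at h1
  rw [integral_sub hiμ.restrict (integrable_const c),
    integral_sub hiν.restrict (integrable_const c)] at h2
  simp only [setIntegral_const, smul_eq_mul, probReal_compl_eq_one_sub hA] at h1 h2
  rw [← integral_add_compl hA hiμ, ← integral_add_compl hA hiν]
  have h3 := mul_le_mul_of_nonneg_left (sub_le_tvDist μ ν hA) (sub_nonneg.2 hcC)
  linarith

end TotalVariation

section Normalization

variable {α : Type*} [MeasurableSpace α]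

theorem real_normalized_withDensity (lam : Measure α) {f : α → ℝ}
    (hf : Integrable f lam) (hf0 : ∀ x, 0 ≤ f x) {A : Set α} (hA : MeasurableSet A) :
    ((∫⁻ z, ENNReal.ofReal (f z) ∂lam)⁻¹ •
      lam.withDensity fun z => ENNReal.ofReal (f z)).real A =
      (∫ z, f z ∂lam)⁻¹ * ∫ z in A, f z ∂lam := by
  rw [measureReal_def, Measure.smul_apply, withDensity_apply _ hA, smul_eq_mul, ENNReal.toReal_mul,
    ENNReal.toReal_inv, integral_eq_lintegral_of_nonneg_ae (Filter.Eventually.of_forall hf0)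
      hf.aestronglyMeasurable,
    integral_eq_lintegral_of_nonneg_ae (Filter.Eventually.of_forall hf0)
      hf.restrict.aestronglyMeasurable]

end Normalization

section FilterStep

variable {S : Type*} [MeasurableSpace S] {lam : Measure S} {q : S → S → ℝ} {h : ℕ → S → ℝ}
  {c C : ℝ}

theorem measurable_integral_kernel (hq : Measurable (Function.uncurry q)) (μ : Measure S)
    [IsProbabilityMeasure μ] : Measurable fun z => ∫ x, q x z ∂μ :=
  (hq.stronglyMeasurable.integral_prod_left' (μ := μ)).measurable

theorem filter_density_mem_Icc (hc : 0 < c) (hq : Measurable (Function.uncurry q))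
    (hqc : ∀ x z, q x z ∈ Set.Icc c C) (hhc : ∀ p z, h p z ∈ Set.Icc c C) (p : ℕ)
    (μ : Measure S) [IsProbabilityMeasure μ] (z : S) :
    h p z * ∫ x, q x z ∂μ ∈ Set.Icc (c * c) (C * C) := by
  have hg := integral_mem_Icc μ (hq.comp measurable_prodMk_right) fun x => hqc x z
  have hz := hhc p z
  exact ⟨mul_le_mul hz.1 hg.1 hc.le (hc.le.trans hz.1),
    mul_le_mul hz.2 hg.2 (hc.le.trans hg.1) ((hc.le.trans hz.1).trans hz.2)⟩

theorem integrable_filter_density [IsFiniteMeasure lam] (hc : 0 < c)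
    (hq : Measurable (Function.uncurry q)) (hh : ∀ p, Measurable (h p))
    (hqc : ∀ x z, q x z ∈ Set.Icc c C) (hhc : ∀ p z, h p z ∈ Set.Icc c C) (p : ℕ)
    (μ : Measure S) [IsProbabilityMeasure μ] :
    Integrable (fun z => h p z * ∫ x, q x z ∂μ) lam :=
  integrable_of_mem_Icc lam ((hh p).mul (measurable_integral_kernel hq μ))
    (filter_density_mem_Icc hc hq hqc hhc p μ)

theorem integral_filter_density_pos [IsFiniteMeasure lam] [NeZero lam] (hc : 0 < c)
    (hq : Measurable (Function.uncurry q)) (hh : ∀ p, Measurable (h p))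
    (hqc : ∀ x z, q x z ∈ Set.Icc c C) (hhc : ∀ p z, h p z ∈ Set.Icc c C) (p : ℕ)
    (μ : Measure S) [IsProbabilityMeasure μ] :
    0 < ∫ z, h p z * ∫ x, q x z ∂μ ∂lam := by
  have h1 := integral_mono (integrable_const (c * c))
    (integrable_filter_density (lam := lam) hc hq hh hqc hhc p μ)
    fun z => (filter_density_mem_Icc hc hq hqc hhc p μ z).1
  rw [integral_const, smul_eq_mul] at h1
  have h2 : 0 < lam.real Set.univ := measureReal_univ_pos
  exact (by positivity : 0 < lam.real Set.univ * (c * c)).trans_le h1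

theorem filterStep_real_apply [IsFiniteMeasure lam] (hc : 0 < c)
    (hq : Measurable (Function.uncurry q)) (hh : ∀ p, Measurable (h p))
    (hqc : ∀ x z, q x z ∈ Set.Icc c C) (hhc : ∀ p z, h p z ∈ Set.Icc c C) (p : ℕ)
    (μ : Measure S) [IsProbabilityMeasure μ] {A : Set S} (hA : MeasurableSet A) :
    (filterStep lam q h p μ).real A =
      (∫ z, h p z * ∫ x, q x z ∂μ ∂lam)⁻¹ * ∫ z in A, h p z * ∫ x, q x z ∂μ ∂lam :=
  real_normalized_withDensity lam (integrable_filter_density hc hq hh hqc hhc p μ)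
    (fun z => (mul_pos hc hc).le.trans (filter_density_mem_Icc hc hq hqc hhc p μ z).1) hA

theorem isProbabilityMeasure_filterStep [IsFiniteMeasure lam] [NeZero lam] (hc : 0 < c)
    (hq : Measurable (Function.uncurry q)) (hh : ∀ p, Measurable (h p))
    (hqc : ∀ x z, q x z ∈ Set.Icc c C) (hhc : ∀ p z, h p z ∈ Set.Icc c C) (p : ℕ)
    (μ : Measure S) [IsProbabilityMeasure μ] :
    IsProbabilityMeasure (filterStep lam q h p μ) := by
  have h1 := filterStep_real_apply (lam := lam) hc hq hh hqc hhc p μ MeasurableSet.univ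
  rw [setIntegral_univ, inv_mul_cancel₀
    (integral_filter_density_pos (lam := lam) hc hq hh hqc hhc p μ).ne'] at h1
  exact ⟨(ENNReal.toReal_eq_one_iff _).1 h1⟩

/-- Up to a common factor, `μ` lies between `a • ν` and `b • ν`, with `δ ≤ a` and `b - a ≤ D`. -/
def RatioOscLE (δ D : ℝ) (μ ν : Measure S) : Prop :=
  ∃ t a b : ℝ, 0 < t ∧ δ ≤ a ∧ b - a ≤ D ∧
    ∀ A, MeasurableSet A → t * a * ν.real A ≤ μ.real A ∧ μ.real A ≤ t * b * ν.real A

theorem RatioOscLE.tvDist_le {δ D : ℝ} {μ ν : Measure S} [IsProbabilityMeasure μ]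
    [IsProbabilityMeasure ν] (hδ : 0 < δ) (H : RatioOscLE δ D μ ν) : tvDist μ ν ≤ D / δ := by
  obtain ⟨t, a, b, ht, ha, hab, H⟩ := H
  obtain ⟨hta, htb⟩ := H _ MeasurableSet.univ
  simp only [probReal_univ, mul_one] at hta htb
  have hab0 : a ≤ b := le_of_mul_le_mul_left (hta.trans htb) ht
  have hkey : t * b - t * a ≤ D / δ := by
    rw [le_div_iff₀ hδ]
    calc (t * b - t * a) * δ = (b - a) * (t * δ) := by ring
      _ ≤ (b - a) * 1 := by
        refine mul_le_mul_of_nonneg_left ?_ (sub_nonneg.2 hab0)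
        exact (mul_le_mul_of_nonneg_left ha ht.le).trans hta
      _ ≤ D := by linarith
  refine ciSup_le fun ⟨A, hA⟩ => ?_
  obtain ⟨h1, h2⟩ := H A hA
  have h3 : ν.real A ≤ 1 := measureReal_le_one
  have h4 : 0 ≤ ν.real A := measureReal_nonneg
  change |μ.real A - ν.real A| ≤ _
  refine abs_le.2 ⟨?_, ?_⟩ <;> nlinarith

/-- Pointwise comparison of the predicted densities passes to the updated filters. -/
theorem ratioOscLE_filterStep [IsFiniteMeasure lam] [NeZero lam] (hc : 0 < c)
    (hq : Measurable (Function.uncurry q)) (hh : ∀ p, Measurable (h p))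
    (hqc : ∀ x z, q x z ∈ Set.Icc c C) (hhc : ∀ p z, h p z ∈ Set.Icc c C) (p : ℕ)
    (μ ν : Measure S) [IsProbabilityMeasure μ] [IsProbabilityMeasure ν] {δ D a b s : ℝ}
    (hs : 0 < s) (ha : δ ≤ a) (hab : b - a ≤ D)
    (hlow : ∀ z, s * a * ∫ x, q x z ∂ν ≤ ∫ x, q x z ∂μ)
    (hupp : ∀ z, ∫ x, q x z ∂μ ≤ s * b * ∫ x, q x z ∂ν) :
    RatioOscLE δ D (filterStep lam q h p μ) (filterStep lam q h p ν) := by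
  have hZμ := integral_filter_density_pos (lam := lam) hc hq hh hqc hhc p μ
  have hZν := integral_filter_density_pos (lam := lam) hc hq hh hqc hhc p ν
  have hiμ := integrable_filter_density (lam := lam) hc hq hh hqc hhc p μ
  have hiν := integrable_filter_density (lam := lam) hc hq hh hqc hhc p ν
  have hscale (r : ℝ) (A : Set S) : (∫ z, h p z * ∫ x, q x z ∂μ ∂lam)⁻¹ *
      ∫ z in A, (s * r) * (h p z * ∫ x, q x z ∂ν) ∂lam =
      s * ((∫ z, h p z * ∫ x, q x z ∂ν ∂lam) / ∫ z, h p z * ∫ x, q x z ∂μ ∂lam) * r *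
      ((∫ z, h p z * ∫ x, q x z ∂ν ∂lam)⁻¹ * ∫ z in A, h p z * ∫ x, q x z ∂ν ∂lam) := by
    rw [integral_const_mul]
    field_simp
  refine ⟨_, a, b, mul_pos hs (div_pos hZν hZμ), ha, hab, fun A hA => ?_⟩
  rw [filterStep_real_apply hc hq hh hqc hhc p μ hA, filterStep_real_apply hc hq hh hqc hhc p ν hA,
    ← hscale a A, ← hscale b A]
  have hh0 (z : S) : 0 ≤ h p z := hc.le.trans (hhc p z).1
  constructor
  · refine mul_le_mul_of_nonneg_left (integral_mono (hiν.const_mul _).restrict hiμ.restrict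
      fun z => ?_) (inv_nonneg.2 hZμ.le)
    have := mul_le_mul_of_nonneg_left (hlow z) (hh0 z)
    dsimp only
    linarith
  · refine mul_le_mul_of_nonneg_left (integral_mono hiμ.restrict (hiν.const_mul _).restrict
      fun z => ?_) (inv_nonneg.2 hZμ.le)
    have := mul_le_mul_of_nonneg_left (hupp z) (hh0 z)
    dsimp only
    linarith

theorem mul_integral_le_of_forall_real_le (μ ν : Measure S) [IsFiniteMeasure μ]
    [IsFiniteMeasure ν] {r : ℝ} (hr : 0 ≤ r)
    (H : ∀ A, MeasurableSet A → r * ν.real A ≤ μ.real A) {f : S → ℝ} (hf0 : ∀ x, 0 ≤ f x)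
    (hf : Integrable f μ) : r * ∫ x, f x ∂ν ≤ ∫ x, f x ∂μ := by
  have hle : ENNReal.ofReal r • ν ≤ μ := by
    refine Measure.le_iff.2 fun A hA => ?_
    rw [Measure.smul_apply, smul_eq_mul, ← ofReal_measureReal, ← ofReal_measureReal,
      ← ENNReal.ofReal_mul hr]
    exact ENNReal.ofReal_le_ofReal (H A hA)
  have := integral_mono_measure hle (Filter.Eventually.of_forall hf0) hf
  rwa [integral_smul_measure, ENNReal.toReal_ofReal hr, smul_eq_mul] at this

/-- The first filter step turns total variation closeness into closeness of ratios. -/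
theorem ratioOscLE_filterStep_of_tvDist [IsFiniteMeasure lam] [NeZero lam] (hc : 0 < c)
    (hcC : c ≤ C) (hq : Measurable (Function.uncurry q)) (hh : ∀ p, Measurable (h p))
    (hqc : ∀ x z, q x z ∈ Set.Icc c C) (hhc : ∀ p z, h p z ∈ Set.Icc c C) (p : ℕ)
    (μ ν : Measure S) [IsProbabilityMeasure μ] [IsProbabilityMeasure ν] :
    RatioOscLE (c / C) (2 * ((C - c) / c) * tvDist μ ν)
      (filterStep lam q h p μ) (filterStep lam q h p ν) := by
  have hC : 0 < C := hc.trans_le hcC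
  have hK : 0 ≤ (C - c) / c * tvDist μ ν :=
    mul_nonneg (div_nonneg (sub_nonneg.2 hcC) hc.le) (tvDist_nonneg μ ν)
  have hKg (g : ℝ) (hg : c ≤ g) : (C - c) * tvDist μ ν ≤ (C - c) / c * tvDist μ ν * g := by
    calc (C - c) * tvDist μ ν = (C - c) / c * tvDist μ ν * c := by field_simp
      _ ≤ _ := mul_le_mul_of_nonneg_left hg hK
  refine ratioOscLE_filterStep hc hq hh hqc hhc p μ ν
    (a := max (c / C) (1 - (C - c) / c * tvDist μ ν)) (b := 1 + (C - c) / c * tvDist μ ν)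
    one_pos (le_max_left _ _) ?_ (fun z => ?_) (fun z => ?_)
  · have := le_max_right (c / C) (1 - (C - c) / c * tvDist μ ν)
    linarith
  all_goals
    have hm : Measurable fun x => q x z := hq.comp measurable_prodMk_right
    have hgμ := integral_mem_Icc μ hm fun x => hqc x z
    have hgν := integral_mem_Icc ν hm fun x => hqc x z
    have hg := hKg _ hgν.1
    rw [one_mul]
  · have hd := integral_sub_integral_le_tvDist ν μ hcC hm fun x => hqc x z
    rw [tvDist_comm] at hd
    rw [max_mul_of_nonneg _ _ (hc.le.trans hgν.1)]
    refine max_le ?_ (by linarith)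
    refine le_trans ?_ hgμ.1
    rw [div_mul_eq_mul_div, div_le_iff₀ hC]
    exact mul_le_mul_of_nonneg_left hgν.2 hc.le
  · have hd := integral_sub_integral_le_tvDist μ ν hcC hm fun x => hqc x z
    linarith

/-- A filter step contracts the oscillation of the ratio. -/
theorem RatioOscLE.contract_filterStep [IsFiniteMeasure lam] [NeZero lam] (hc : 0 < c)
    (hq : Measurable (Function.uncurry q)) (hh : ∀ p, Measurable (h p))
    (hqc : ∀ x z, q x z ∈ Set.Icc c C) (hhc : ∀ p z, h p z ∈ Set.Icc c C) (p : ℕ)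
    {μ ν : Measure S} [IsProbabilityMeasure μ] [IsProbabilityMeasure ν] {δ D ε : ℝ}
    (hδ : 0 < δ) (hε : 0 ≤ ε) (hε1 : ε ≤ 1) (hεc : ε * C ≤ c) (H : RatioOscLE δ D μ ν) :
    RatioOscLE δ ((1 - ε) * D) (filterStep lam q h p μ) (filterStep lam q h p ν) := by
  obtain ⟨t, a, b, ht, ha, hab, H⟩ := H
  obtain ⟨hta, htb⟩ := H _ MeasurableSet.univ
  simp only [probReal_univ, mul_one] at hta htb
  have ha0 : 0 < a := hδ.trans_le ha
  have hb0 : 0 < b := pos_of_mul_pos_right (one_pos.trans_le htb) ht.le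
  have hat : a ≤ 1 / t := by rw [le_div_iff₀ ht]; linarith
  have hscale (r : ℝ) : t * ((1 - ε) * r + ε * (1 / t)) = t * r + ε * (1 - t * r) := by
    field_simp
    ring
  refine ratioOscLE_filterStep hc hq hh hqc hhc p μ ν
    (a := (1 - ε) * a + ε * (1 / t)) (b := (1 - ε) * b + ε * (1 / t)) ht ?_ ?_
    (fun z => ?_) (fun z => ?_)
  · nlinarith
  · nlinarith
  all_goals
    have hm : Measurable fun x => q x z := hq.comp measurable_prodMk_right
    have hiμ := integrable_of_mem_Icc μ hm fun x => hqc x z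
    have hiν := integrable_of_mem_Icc ν hm fun x => hqc x z
    have hgν := integral_mem_Icc ν hm fun x => hqc x z
    have hεg : ε * ∫ x, q x z ∂ν ≤ c := (mul_le_mul_of_nonneg_left hgν.2 hε).trans hεc
    have hq0 (x : S) : 0 ≤ q x z - c := sub_nonneg.2 (hqc x z).1
    rw [hscale]
  · have h1 := mul_integral_le_of_forall_real_le μ ν (mul_pos ht ha0).le
      (fun A hA => (H A hA).1) hq0 (hiμ.sub (integrable_const c))
    rw [integral_sub hiμ (integrable_const c), integral_sub hiν (integrable_const c)] at h1
    simp only [integral_const, probReal_univ, one_smul] at h1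
    have h2 := mul_le_mul_of_nonneg_left hεg (sub_nonneg.2 hta)
    linarith
  · have htb0 : 0 < t * b := mul_pos ht hb0
    have h1 := mul_integral_le_of_forall_real_le ν μ (inv_pos.2 htb0).le
      (fun A hA => (inv_mul_le_iff₀ htb0).2 (H A hA).2) hq0 (hiν.sub (integrable_const c))
    rw [inv_mul_le_iff₀ htb0, integral_sub hiμ (integrable_const c),
      integral_sub hiν (integrable_const c)] at h1
    simp only [integral_const, probReal_univ, one_smul] at h1
    have h2 := mul_le_mul_of_nonneg_left hεg (sub_nonneg.2 htb)
    linarith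

end FilterStep

/-- Exponential stability of the filter flow under two-sided bounds.
If `c ≤ q ≤ C` and `c ≤ h_p ≤ C` with `0 < c ≤ C < ∞`, on a space with finite nonzero
measure `λ`, then there exist `ρ ∈ (0,1)` and `C' < ∞`, depending only on `c`, `C` and
`λ(S)`, such that for all `0 ≤ p < n` and all probability measures `μ, ν`,
`‖(Φ_n ∘ ⋯ ∘ Φ_{p+1})(μ) − (Φ_n ∘ ⋯ ∘ Φ_{p+1})(ν)‖_TV ≤ C' ρ^{n−p} ‖μ − ν‖_TV`. -/
theorem filter_flow_exponential_stability.{u} :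
    ∀ (c C : ℝ) (V : ℝ≥0∞), 0 < c → c ≤ C → V ≠ 0 → V ≠ ⊤ →
    ∃ ρ : ℝ, ρ ∈ Set.Ioo (0:ℝ) 1 ∧
    ∃ C' : ℝ, 0 ≤ C' ∧
      ∀ (S : Type u) (_ : MeasurableSpace S) (lam : Measure S), lam Set.univ = V →
      ∀ (q : S → S → ℝ) (h : ℕ → S → ℝ),
        Measurable (Function.uncurry q) → (∀ p, Measurable (h p)) →
        (∀ x z, q x z ∈ Set.Icc c C) → (∀ p z, h p z ∈ Set.Icc c C) →
      ∀ (p n : ℕ), p < n →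
      ∀ (Mu Nu : ℕ → Measure S),
        IsProbabilityMeasure (Mu p) → IsProbabilityMeasure (Nu p) →
        (∀ k, p ≤ k → k < n → Mu (k + 1) = filterStep lam q h (k + 1) (Mu k)) →
        (∀ k, p ≤ k → k < n → Nu (k + 1) = filterStep lam q h (k + 1) (Nu k)) →
        tvDist (Mu n) (Nu n) ≤ C' * ρ ^ (n - p) * tvDist (Mu p) (Nu p) := by
  intro c C V hc hcC hV0 hVtop
  have hC : 0 < C := hc.trans_le hcC
  have hε : 0 < c / (2 * C) := by positivity
  have hε1 : c / (2 * C) < 1 := by rw [div_lt_one (by positivity)]; linarith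
  have hεc : c / (2 * C) * C ≤ c := by
    have : c / (2 * C) * C = c / 2 := by field_simp
    linarith
  have hρ : 0 < 1 - c / (2 * C) := sub_pos.2 hε1
  have hCc : 0 ≤ C - c := sub_nonneg.2 hcC
  refine ⟨1 - c / (2 * C), ⟨hρ, by linarith⟩,
    2 * ((C - c) / c) / (c / C) / (1 - c / (2 * C)), by positivity, ?_⟩
  intro S _ lam hlam q h hq hh hqc hhc p n hpn Mu Nu hMu hNu hstepMu hstepNu
  have : IsFiniteMeasure lam := ⟨by rw [hlam]; exact hVtop.lt_top⟩
  have : NeZero lam := ⟨by rintro rfl; exact hV0 (by simpa using hlam.symm)⟩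
  have key : ∀ m, p + m + 1 ≤ n →
      IsProbabilityMeasure (Mu (p + m + 1)) ∧ IsProbabilityMeasure (Nu (p + m + 1)) ∧
      RatioOscLE (c / C) ((1 - c / (2 * C)) ^ m * (2 * ((C - c) / c) * tvDist (Mu p) (Nu p)))
        (Mu (p + m + 1)) (Nu (p + m + 1)) := by
    intro m
    induction m with
    | zero =>
      intro hm
      rw [hstepMu (p + 0) (by omega) (by omega), hstepNu (p + 0) (by omega) (by omega),
        add_zero, pow_zero, one_mul]
      exact ⟨isProbabilityMeasure_filterStep hc hq hh hqc hhc _ _,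
        isProbabilityMeasure_filterStep hc hq hh hqc hhc _ _,
        ratioOscLE_filterStep_of_tvDist hc hcC hq hh hqc hhc _ _ _⟩
    | succ m ih =>
      intro hm
      obtain ⟨h1, h2, h3⟩ := ih (by omega)
      rw [hstepMu (p + (m + 1)) (by omega) (by omega), hstepNu (p + (m + 1)) (by omega) (by omega),
        ← add_assoc, pow_succ', mul_assoc]
      exact ⟨isProbabilityMeasure_filterStep hc hq hh hqc hhc _ _,
        isProbabilityMeasure_filterStep hc hq hh hqc hhc _ _,
        h3.contract_filterStep hc hq hh hqc hhc _ (by positivity) hε.le hε1.le hεc⟩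
  obtain ⟨m, rfl⟩ : ∃ m, n = p + m + 1 := ⟨n - p - 1, by omega⟩
  obtain ⟨h1, h2, h3⟩ := key m le_rfl
  refine (h3.tvDist_le (by positivity)).trans_eq ?_
  rw [show p + m + 1 - p = m + 1 by omega, pow_succ]
  have hρ' := hρ.ne'
  generalize 1 - c / (2 * C) = ρ at hρ' ⊢
  field_simp
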